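/- arXiv:1107.3998 — 7 statements merged into one kernel-verified Lean document; each statement's English description precedes it below -/
import Mathlib

section
/- Let φ : ℝ² → ℝ² be a smooth bijection with smooth inverse such that φ(z + n) = φ(z) + n for all z ∈ ℝ², n ∈ ℤ², and det ∇φ > 0 everywhere (a lift of an orientation-preserving diffeomorphism of the torus). Then for all smooth ℤ²-periodic maps v, w : ℝ² → ℝ², defining Ad_φ v := [(∇φ)·v] ∘ φ⁻¹, one has ∫_{[0,1]²} (Ad_φ v)·w d(x,y) = ∫_{[0,1]²} v·[(∇φ)ᵀ (w∘φ) det ∇φ] d(x,y); that is, the adjoint of Ad_φ with respect to the L² pairing is Ad*_φ w = (∇φ)ᵀ (w∘φ) |∇φ|. -/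
open MeasureTheory Real

noncomputable section

/-- Euclidean dot product on `ℝ × ℝ`. -/
def dot2 (a b : ℝ × ℝ) : ℝ := a.1 * b.1 + a.2 * b.2

/-- The Jacobian matrix of `f` at `z` applied to the vector `v`, i.e. `∇f·v`. -/
def jac (f : ℝ × ℝ → ℝ × ℝ) (z v : ℝ × ℝ) : ℝ × ℝ := fderiv ℝ f z v

/-- The transposed Jacobian of `f` at `z` applied to `m`, i.e. `(∇f)ᵀ m`. -/
def jacT (f : ℝ × ℝ → ℝ × ℝ) (z m : ℝ × ℝ) : ℝ × ℝ :=
  (dot2 (fderiv ℝ f z (1, 0)) m, dot2 (fderiv ℝ f z (0, 1)) m)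

/-- The divergence `∇·f`. -/
def div2 (f : ℝ × ℝ → ℝ × ℝ) (z : ℝ × ℝ) : ℝ :=
  (fderiv ℝ f z (1, 0)).1 + (fderiv ℝ f z (0, 1)).2

/-- The componentwise Laplacian `Δf = ∂ₓ²f + ∂ᵧ²f`. -/
def lap2 (f : ℝ × ℝ → ℝ × ℝ) (z : ℝ × ℝ) : ℝ × ℝ :=
  fderiv ℝ (fun w => fderiv ℝ f w (1, 0)) z (1, 0) +
  fderiv ℝ (fun w => fderiv ℝ f w (0, 1)) z (0, 1)

/-- The Laplacian of a scalar function on `ℝ²`. -/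
def lapS (f : ℝ × ℝ → ℝ) (z : ℝ × ℝ) : ℝ :=
  fderiv ℝ (fun w => fderiv ℝ f w (1, 0)) z (1, 0) +
  fderiv ℝ (fun w => fderiv ℝ f w (0, 1)) z (0, 1)

/-- A map on `ℝ²` is `ℤ²`-periodic (i.e. descends to the torus `𝕋 = (ℝ/ℤ)²`). -/
def Periodic2 {α : Type*} (f : ℝ × ℝ → α) : Prop :=
  ∀ (z : ℝ × ℝ) (n : ℤ × ℤ), f (z + ((n.1 : ℝ), (n.2 : ℝ))) = f z

/-- The fundamental domain `[0,1]²` of the torus. -/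
def sq01 : Set (ℝ × ℝ) := Set.Icc (0, 0) (1, 1)

/-- The determinant of the Jacobian `∇f` at `z`, i.e. `|∇f|`. -/
def detJac (f : ℝ × ℝ → ℝ × ℝ) (z : ℝ × ℝ) : ℝ :=
  (fderiv ℝ f z (1, 0)).1 * (fderiv ℝ f z (0, 1)).2 -
  (fderiv ℝ f z (0, 1)).1 * (fderiv ℝ f z (1, 0)).2

/-- The subgroup `ℤ²` of `ℝ²`. -/
def intLattice2 : AddSubgroup (ℝ × ℝ) :=
  ((Int.castAddHom ℝ).prodMap (Int.castAddHom ℝ)).range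

instance : Countable intLattice2 :=
  (AddMonoidHom.rangeRestrict_surjective
    ((Int.castAddHom ℝ).prodMap (Int.castAddHom ℝ))).countable

lemma intCast_mem_intLattice2 (n : ℤ × ℤ) : ((n.1 : ℝ), (n.2 : ℝ)) ∈ intLattice2 := ⟨n, rfl⟩

/-- A measurable set containing exactly one representative of each class modulo `ℤ²` is a
fundamental domain. -/
lemma isAddFundamentalDomain_intLattice2 {s : Set (ℝ × ℝ)} (hs : MeasurableSet s)
    (h : ∀ x : ℝ × ℝ, ∃! n : ℤ × ℤ, x + ((n.1 : ℝ), (n.2 : ℝ)) ∈ s) :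
    IsAddFundamentalDomain intLattice2 s := by
  refine IsAddFundamentalDomain.mk' hs.nullMeasurableSet fun x => ?_
  obtain ⟨n, hn, huniq⟩ := h x
  refine ⟨⟨_, intCast_mem_intLattice2 n⟩, ?_, ?_⟩
  · simpa [AddSubgroup.vadd_def, add_comm] using hn
  · rintro ⟨_, m, rfl⟩ hm
    have : m = n := huniq m (by
      simpa [AddSubgroup.vadd_def, Prod.map, add_comm] using hm)
    subst this
    rfl

/-- Every point of `ℝ²` has exactly one `ℤ²`-translate in `[0,1)²`. -/
lemma existsUnique_add_intCast_mem_Ico_prod (x : ℝ × ℝ) :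
    ∃! n : ℤ × ℤ, x + ((n.1 : ℝ), (n.2 : ℝ)) ∈ Set.Ico (0 : ℝ) 1 ×ˢ Set.Ico (0 : ℝ) 1 := by
  obtain ⟨a, ha, ha'⟩ := existsUnique_add_zsmul_mem_Ico one_pos x.1 0
  obtain ⟨b, hb, hb'⟩ := existsUnique_add_zsmul_mem_Ico one_pos x.2 0
  simp only [zsmul_eq_mul, mul_one, zero_add] at ha ha' hb hb'
  exact ⟨(a, b), ⟨ha, hb⟩, fun n hn => Prod.ext (ha' _ hn.1) (hb' _ hn.2)⟩

lemma sq01_ae_eq_Ico_prod :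
    sq01 =ᵐ[volume] (Set.Ico (0 : ℝ) 1 ×ˢ Set.Ico (0 : ℝ) 1 : Set (ℝ × ℝ)) := by
  rw [sq01, ← Set.Icc_prod_Icc]
  exact Measure.set_prod_ae_eq Ico_ae_eq_Icc.symm Ico_ae_eq_Icc.symm

lemma det_fderiv_eq_detJac (f : ℝ × ℝ → ℝ × ℝ) (z : ℝ × ℝ) :
    (fderiv ℝ f z).det = detJac f z := by
  rw [ContinuousLinearMap.det, ← LinearMap.det_toMatrix (Module.Basis.finTwoProd ℝ),
    Matrix.det_fin_two]
  simp [LinearMap.toMatrix_apply, detJac]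

lemma dot2_jac_eq_dot2_jacT (f : ℝ × ℝ → ℝ × ℝ) (z v m : ℝ × ℝ) :
    dot2 (jac f z v) m = dot2 v (jacT f z m) := by
  have hv : v = v.1 • ((1 : ℝ), (0 : ℝ)) + v.2 • ((0 : ℝ), (1 : ℝ)) := by ext <;> simp
  have : fderiv ℝ f z v = v.1 • fderiv ℝ f z (1, 0) + v.2 • fderiv ℝ f z (0, 1) := by
    conv_lhs => rw [hv]
    rw [map_add, map_smul, map_smul]
  simp only [jac, jacT, dot2, this, Prod.fst_add, Prod.snd_add, Prod.smul_fst, Prod.smul_snd,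
    smul_eq_mul]
  ring

/-- The derivative of a map commuting with translation by `c` is invariant under that
translation. -/
lemma fderiv_add_of_map_add {f : ℝ × ℝ → ℝ × ℝ} {c : ℝ × ℝ} (h : ∀ z, f (z + c) = f z + c)
    (z : ℝ × ℝ) : fderiv ℝ f (z + c) = fderiv ℝ f z := by
  rw [← fderiv_comp_add_right, funext h, fderiv_add_const]

/-- Change of variables on the torus: the integral of a periodic function is computed by pulling
back along a lift of an orientation-preserving diffeomorphism. -/
lemma setIntegral_sq01_eq_setIntegral_detJac_mul {φ ψ : ℝ × ℝ → ℝ × ℝ}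
    (hφ : Differentiable ℝ φ) (hψ : Measurable ψ)
    (hinv : Function.LeftInverse ψ φ) (hinv' : Function.RightInverse ψ φ)
    (hlift : ∀ (z : ℝ × ℝ) (n : ℤ × ℤ),
      φ (z + ((n.1 : ℝ), (n.2 : ℝ))) = φ z + ((n.1 : ℝ), (n.2 : ℝ)))
    (hdet : ∀ z : ℝ × ℝ, 0 < detJac φ z) {F : ℝ × ℝ → ℝ} (hF : Periodic2 F) :
    ∫ z in sq01, F z = ∫ z in sq01, detJac φ z * F (φ z) := by
  set D : Set (ℝ × ℝ) := Set.Ico (0 : ℝ) 1 ×ˢ Set.Ico (0 : ℝ) 1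
  have hD : MeasurableSet D := measurableSet_Ico.prod measurableSet_Ico
  have himage : φ '' D = ψ ⁻¹' D := congrFun (Set.image_eq_preimage_of_inverse hinv hinv') D
  have hψlift (x : ℝ × ℝ) (n : ℤ × ℤ) :
      ψ (x + ((n.1 : ℝ), (n.2 : ℝ))) = ψ x + ((n.1 : ℝ), (n.2 : ℝ)) := by
    rw [← hinv (ψ x + _), hlift, hinv']
  have hfund : IsAddFundamentalDomain intLattice2 D :=
    isAddFundamentalDomain_intLattice2 hD existsUnique_add_intCast_mem_Ico_prod
  have hfund' : IsAddFundamentalDomain intLattice2 (φ '' D) := by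
    rw [himage]
    refine isAddFundamentalDomain_intLattice2 (hψ hD) fun x => ?_
    simpa only [Set.mem_preimage, hψlift] using existsUnique_add_intCast_mem_Ico_prod (ψ x)
  rw [setIntegral_congr_set sq01_ae_eq_Ico_prod, setIntegral_congr_set sq01_ae_eq_Ico_prod,
    hfund.setIntegral_eq hfund' ?_,
    integral_image_eq_integral_abs_det_fderiv_smul volume hD
      (fun z _ => (hφ z).hasFDerivAt.hasFDerivWithinAt) hinv.injective.injOn]
  · simp only [det_fderiv_eq_detJac, abs_of_pos (hdet _), smul_eq_mul]
    rfl
  · rintro ⟨_, n, rfl⟩ x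
    simpa [AddSubgroup.vadd_def, Prod.map, add_comm] using hF x n

/-- for a lift `φ` of an orientation-preserving diffeomorphism of the torus
(with inverse `ψ`), the adjoint of `Ad_φ v = [(∇φ)·v] ∘ φ⁻¹` with respect to the `L²`
pairing is `Ad*_φ w = (∇φ)ᵀ (w∘φ) |∇φ|`. -/
theorem adjoint_of_Ad (φ ψ : ℝ × ℝ → ℝ × ℝ)
    (hφ : ContDiff ℝ (⊤ : ℕ∞) φ) (hψ : ContDiff ℝ (⊤ : ℕ∞) ψ)
    (hinv : Function.LeftInverse ψ φ) (hinv' : Function.RightInverse ψ φ)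
    (hlift : ∀ (z : ℝ × ℝ) (n : ℤ × ℤ), φ (z + ((n.1 : ℝ), (n.2 : ℝ))) = φ z + ((n.1 : ℝ), (n.2 : ℝ)))
    (hdet : ∀ z : ℝ × ℝ, 0 < detJac φ z)
    (v w : ℝ × ℝ → ℝ × ℝ)
    (hv : ContDiff ℝ (⊤ : ℕ∞) v) (hw : ContDiff ℝ (⊤ : ℕ∞) w)
    (hvp : Periodic2 v) (hwp : Periodic2 w) :
    ∫ z in sq01, dot2 (jac φ (ψ z) (v (ψ z))) (w z) =
      ∫ z in sq01, dot2 (v z) (detJac φ z • jacT φ z (w (φ z))) := by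
  have hψlift (x : ℝ × ℝ) (n : ℤ × ℤ) :
      ψ (x + ((n.1 : ℝ), (n.2 : ℝ))) = ψ x + ((n.1 : ℝ), (n.2 : ℝ)) := by
    rw [← hinv (ψ x + _), hlift, hinv']
  have hF : Periodic2 fun z => dot2 (jac φ (ψ z) (v (ψ z))) (w z) := fun z n => by
    simp only [jac, hψlift, hvp _ n, hwp z n, fderiv_add_of_map_add (fun z => hlift z n)]
  rw [setIntegral_sq01_eq_setIntegral_detJac_mul (hφ.differentiable (by simp))
    hψ.continuous.measurable hinv hinv' hlift hdet hF]
  congr 1 with z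
  rw [hinv, dot2_jac_eq_dot2_jacT]
  simp only [dot2, Prod.smul_fst, Prod.smul_snd, smul_eq_mul]
  ring
end
end

section
/- For every smooth map u : ℝ² → ℝ² and every smooth function w : ℝ² → ℝ, the pointwise identity u·∇(w − Δw) − (1 − Δ)(∇w·u) = ∇w·Δu + 2∇(∂ₓw)·∂ₓu + 2∇(∂ᵧw)·∂ᵧu holds on ℝ² (where ∇w·u = u·∇w is the directional derivative of w along u and Δu acts componentwise). Consequently, u·∇(𝔸v) − 𝔸(∇v·u) contains no derivatives of v of order higher than s when v ∈ H^s, which shows that the Christoffel operator Γ maps H^s(𝕋) × H^s(𝕋) to H^s(𝕋). -/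
open MeasureTheory Real

noncomputable section

section DirectionalDerivative

variable {E F : Type*} [NormedAddCommGroup E] [NormedSpace ℝ E]
  [NormedAddCommGroup F] [NormedSpace ℝ F]

/-- Directional derivatives of smooth functions are smooth. -/
theorem ContDiff.fderiv_apply_const {f : E → F} (hf : ContDiff ℝ (⊤ : ℕ∞) f) (e : E) :
    ContDiff ℝ (⊤ : ℕ∞) (fun y => fderiv ℝ f y e) :=
  (hf.fderiv_right (m := (⊤ : ℕ∞)) (by simp)).clm_apply contDiff_const

/-- Product rule for the derivative of `w` along a vector field `u`. -/
theorem fderiv_fderiv_apply_vectorField {u : E → E} {w : E → F}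
    (hu : ContDiff ℝ (⊤ : ℕ∞) u) (hw : ContDiff ℝ (⊤ : ℕ∞) w) (z e : E) :
    fderiv ℝ (fun y => fderiv ℝ w y (u y)) z e =
      fderiv ℝ w z (fderiv ℝ u z e) + fderiv ℝ (fun y => fderiv ℝ w y e) z (u z) := by
  have hdw : DifferentiableAt ℝ (fderiv ℝ w) z :=
    (hw.fderiv_right (m := (⊤ : ℕ∞)) (by simp)).differentiable (by simp) z
  have hdu : DifferentiableAt ℝ u z := hu.differentiable (by simp) z
  have hsymm : IsSymmSndFDerivAt ℝ w z :=
    hw.contDiffAt.isSymmSndFDerivAt (by simpa using WithTop.coe_le_coe.2 (le_top (a := (2 : ℕ∞))))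
  rw [fderiv_clm_apply hdw hdu, fderiv_clm_apply hdw (differentiableAt_const e)]
  simp [hsymm.eq e (u z)]

/-- Second-order product rule for the derivative of `w` along a vector field `u`. -/
theorem fderiv_fderiv_fderiv_apply_vectorField {u : E → E} {w : E → F}
    (hu : ContDiff ℝ (⊤ : ℕ∞) u) (hw : ContDiff ℝ (⊤ : ℕ∞) w) (z e : E) :
    fderiv ℝ (fun x => fderiv ℝ (fun y => fderiv ℝ w y (u y)) x e) z e =
      fderiv ℝ w z (fderiv ℝ (fun x => fderiv ℝ u x e) z e) +
      (2 : ℝ) • fderiv ℝ (fun y => fderiv ℝ w y e) z (fderiv ℝ u z e) +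
      fderiv ℝ (fun x => fderiv ℝ (fun y => fderiv ℝ w y e) x e) z (u z) := by
  have hue := hu.fderiv_apply_const e
  have hwe := hw.fderiv_apply_const e
  have hdw : ContDiff ℝ (⊤ : ℕ∞) (fderiv ℝ w) := hw.fderiv_right (by simp)
  have hdwe : ContDiff ℝ (⊤ : ℕ∞) (fderiv ℝ fun y => fderiv ℝ w y e) :=
    hwe.fderiv_right (by simp)
  simp_rw [fderiv_fderiv_apply_vectorField hu hw]
  rw [fderiv_fun_add ((hdw.clm_apply hue).differentiable (by simp) z)
    ((hdwe.clm_apply hu).differentiable (by simp) z), add_apply,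
    fderiv_fderiv_apply_vectorField hue hw, fderiv_fderiv_apply_vectorField hu hwe, two_smul]
  abel

end DirectionalDerivative

/-- for smooth `u : ℝ² → ℝ²` and smooth `w : ℝ² → ℝ`, the pointwise identity
`u·∇(w − Δw) − (1 − Δ)(∇w·u) = ∇w·Δu + 2∇(∂ₓw)·∂ₓu + 2∇(∂ᵧw)·∂ᵧu` holds on `ℝ²`. -/
theorem commutator_identity (u : ℝ × ℝ → ℝ × ℝ) (w : ℝ × ℝ → ℝ)
    (hu : ContDiff ℝ (⊤ : ℕ∞) u) (hw : ContDiff ℝ (⊤ : ℕ∞) w) (z : ℝ × ℝ) :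
    fderiv ℝ (fun y => w y - lapS w y) z (u z) -
      ((fun y => fderiv ℝ w y (u y)) z - lapS (fun y => fderiv ℝ w y (u y)) z) =
    fderiv ℝ w z (lap2 u z) +
      2 * fderiv ℝ (fun y => fderiv ℝ w y (1, 0)) z (fderiv ℝ u z (1, 0)) +
      2 * fderiv ℝ (fun y => fderiv ℝ w y (0, 1)) z (fderiv ℝ u z (0, 1)) := by
  have hx := (hw.fderiv_apply_const (1, 0)).fderiv_apply_const (1, 0)
  have hy := (hw.fderiv_apply_const (0, 1)).fderiv_apply_const (0, 1)
  have hdx := hx.differentiable (by simp) z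
  have hdy := hy.differentiable (by simp) z
  have hdw := hw.differentiable (by simp) z
  simp only [lapS, lap2]
  rw [fderiv_fun_sub hdw (hdx.fun_add hdy), fderiv_fun_add hdx hdy,
    fderiv_fderiv_fderiv_apply_vectorField hu hw,
    fderiv_fderiv_fderiv_apply_vectorField hu hw]
  simp only [sub_apply, add_apply, map_add, smul_eq_mul]
  ring
end
end

section
/- For smooth ℤ²-periodic maps f, g : ℝ² → ℝ², define ⟨f, g⟩ := ∫_{[0,1]²} f·(g − Δg) d(x,y). Then for every constant vector c ∈ ℝ² and every smooth ℤ²-periodic v : ℝ² → ℝ², one has −⟨∇v·c, ∇v·c⟩ + ⟨[∇(∇v·c)]·v, c⟩ − ⟨[∇(∇v·c)]·c, v⟩ + ⟨∇v·(∇v·c), c⟩ = 0. In particular, the quantity R(u,v) appearing in the sectional-curvature formula for the 2D Camassa–Holm equation vanishes whenever u is one of the constant vector fields e₁, e₂, so that S(e_i, v) = ⟨Γ(e_i, v), Γ(e_i, v)⟩. -/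
open MeasureTheory Real

noncomputable section

/-- The `H¹`-type inner product `⟨f, g⟩ = ∫ f·(g − Δg)` over `[0,1]²`, with inertia
operator `𝔸 = diag(1−Δ, 1−Δ)`. -/
def innerH1 (f g : ℝ × ℝ → ℝ × ℝ) : ℝ :=
  ∫ z in sq01, dot2 (f z) (g z - lap2 g z)

/-- A directional derivative of a smooth function is smooth. -/
theorem ContDiff.fderiv_apply_smooth {E F : Type*} [NormedAddCommGroup E] [NormedSpace ℝ E]
    [NormedAddCommGroup F] [NormedSpace ℝ F] {f : E → F} {w : E → E}
    (hf : ContDiff ℝ (⊤ : ℕ∞) f) (hw : ContDiff ℝ (⊤ : ℕ∞) w) :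
    ContDiff ℝ (⊤ : ℕ∞) (fun z => fderiv ℝ f z (w z)) :=
  (hf.fderiv_right (by exact_mod_cast le_top)).clm_apply hw

/-- Directional derivatives of a smooth function commute. -/
theorem ContDiff.fderiv_fderiv_apply_comm {E F : Type*} [NormedAddCommGroup E] [NormedSpace ℝ E]
    [NormedAddCommGroup F] [NormedSpace ℝ F] {f : E → F}
    (hf : ContDiff ℝ (⊤ : ℕ∞) f) (z a b : E) :
    fderiv ℝ (fun y => fderiv ℝ f y a) z b = fderiv ℝ (fun y => fderiv ℝ f y b) z a := by
  have hd : DifferentiableAt ℝ (fderiv ℝ f) z :=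
    (hf.fderiv_right (m := (⊤ : ℕ∞)) (by exact_mod_cast le_top)).differentiable (by simp) z
  have hs : IsSymmSndFDerivAt ℝ f z :=
    hf.contDiffAt.isSymmSndFDerivAt (by
      rw [minSmoothness_of_isRCLikeNormedField]; exact WithTop.coe_le_coe.2 le_top)
  simpa [fderiv_clm_apply hd (differentiableAt_const _)] using hs.eq b a

/-- The Laplacian of a smooth map is smooth. -/
theorem contDiff_lap2 {f : ℝ × ℝ → ℝ × ℝ} (hf : ContDiff ℝ (⊤ : ℕ∞) f) :
    ContDiff ℝ (⊤ : ℕ∞) (lap2 f) :=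
  ((hf.fderiv_apply_smooth contDiff_const).fderiv_apply_smooth contDiff_const).add
    ((hf.fderiv_apply_smooth contDiff_const).fderiv_apply_smooth contDiff_const)

/-- The Laplacian of a smooth map commutes with directional derivatives. -/
theorem lap2_fderiv_apply {f : ℝ × ℝ → ℝ × ℝ} (hf : ContDiff ℝ (⊤ : ℕ∞) f) (z c : ℝ × ℝ) :
    lap2 (fun y => fderiv ℝ f y c) z = fderiv ℝ (lap2 f) z c := by
  have hcomm : ∀ e : ℝ × ℝ, fderiv ℝ (fun w => fderiv ℝ (fun y => fderiv ℝ f y c) w e) z e =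
      fderiv ℝ (fun w => fderiv ℝ (fun y => fderiv ℝ f y e) w e) z c := fun e => by
    simp_rw [hf.fderiv_fderiv_apply_comm _ c e]
    exact (hf.fderiv_apply_smooth contDiff_const).fderiv_fderiv_apply_comm z c e
  have hdiff : ∀ e : ℝ × ℝ,
      DifferentiableAt ℝ (fun w => fderiv ℝ (fun y => fderiv ℝ f y e) w e) z := fun e =>
    ((hf.fderiv_apply_smooth contDiff_const).fderiv_apply_smooth contDiff_const).differentiable
      (by simp) z
  unfold lap2
  rw [fderiv_fun_add (hdiff _) (hdiff _), hcomm, hcomm]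
  rfl

/-- The derivative of a periodic map is periodic. -/
theorem Periodic2.fderiv {F : Type*} [NormedAddCommGroup F] [NormedSpace ℝ F]
    {f : ℝ × ℝ → F} (hf : Periodic2 f) : Periodic2 (fderiv ℝ f) := fun z n => by
  rw [← fderiv_comp_add_right]
  simp_rw [hf _ n]

/-- The Laplacian of a periodic map is periodic. -/
theorem Periodic2.lap2 {f : ℝ × ℝ → ℝ × ℝ} (hf : Periodic2 f) : Periodic2 (lap2 f) := by
  have hp : ∀ e : ℝ × ℝ, Periodic2 (fun w => _root_.fderiv ℝ f w e) := fun e z n => by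
    simp only [hf.fderiv z n]
  intro z n
  simp only [_root_.lap2, (hp _).fderiv z n]

/-- The directional derivative of a periodic function has zero mean. -/
theorem integral_sq01_fderiv_apply_eq_zero {G : ℝ × ℝ → ℝ} (hG : ContDiff ℝ 1 G)
    (hp : Periodic2 G) (c : ℝ × ℝ) : ∫ z in sq01, fderiv ℝ G z c = 0 := by
  have hcont : Continuous (fun z => fderiv ℝ G z c) :=
    (hG.continuous_fderiv one_ne_zero).clm_apply continuous_const
  have hder : ∀ (k : ℝ) (z : ℝ × ℝ), HasFDerivAt (fun y => k * G y) (k • fderiv ℝ G z) z :=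
    fun k z => (hG.differentiable one_ne_zero z).hasFDerivAt.const_mul k
  have hsplit : ∀ z, fderiv ℝ G z c =
      (c.1 • fderiv ℝ G z) (1, 0) + (c.2 • fderiv ℝ G z) (0, 1) := fun z => by
    conv_lhs => rw [show c = c.1 • ((1 : ℝ), (0 : ℝ)) + c.2 • ((0 : ℝ), (1 : ℝ)) by ext <;> simp]
    simp only [map_add, map_smul, smul_apply]
  have hx : ∀ y : ℝ, G (1, y) = G (0, y) := fun y => by simpa using hp (0, y) (1, 0)
  have hy : ∀ x : ℝ, G (x, 1) = G (x, 0) := fun x => by simpa using hp (x, 0) (0, 1)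
  have hint : IntegrableOn (fun z => fderiv ℝ G z c) sq01 :=
    hcont.continuousOn.integrableOn_compact isCompact_Icc
  simp_rw [hsplit] at hint ⊢
  rw [sq01, integral_divergence_prod_Icc_of_hasFDerivAt_of_le
    (fun z => c.1 * G z) (fun z => c.2 * G z)
    (fun z => c.1 • fderiv ℝ G z) (fun z => c.2 • fderiv ℝ G z) (0, 0) (1, 1) (by simp)
    (continuous_const.mul hG.continuous).continuousOn
    (continuous_const.mul hG.continuous).continuousOn
    (fun z _ => hder _ z) (fun z _ => hder _ z) hint]
  simp [hx, hy]

/-- The Laplacian of a constant map vanishes. -/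
theorem lap2_const (c z : ℝ × ℝ) : lap2 (fun _ => c) z = 0 := by
  simp [lap2]

/-- The integrand of `innerH1` is integrable for smooth maps. -/
theorem integrableOn_innerH1 {f g : ℝ × ℝ → ℝ × ℝ} (hf : ContDiff ℝ (⊤ : ℕ∞) f)
    (hg : ContDiff ℝ (⊤ : ℕ∞) g) :
    IntegrableOn (fun z => dot2 (f z) (g z - lap2 g z)) sq01 := by
  refine ContinuousOn.integrableOn_compact isCompact_Icc (Continuous.continuousOn ?_)
  have h1 := hf.continuous
  have h2 := hg.continuous
  have h3 := (contDiff_lap2 hg).continuous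
  unfold dot2
  fun_prop

/-- The product rule for the Euclidean dot product. -/
theorem fderiv_dot2_apply {f g : ℝ × ℝ → ℝ × ℝ} {z : ℝ × ℝ} (hf : DifferentiableAt ℝ f z)
    (hg : DifferentiableAt ℝ g z) (c : ℝ × ℝ) :
    fderiv ℝ (fun y => dot2 (f y) (g y)) z c =
      dot2 (fderiv ℝ f z c) (g z) + dot2 (f z) (fderiv ℝ g z c) := by
  have h := (hf.hasFDerivAt.fst.mul hg.hasFDerivAt.fst).add
    (hf.hasFDerivAt.snd.mul hg.hasFDerivAt.snd)
  have h' : HasFDerivAt (fun y => dot2 (f y) (g y)) _ z := h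
  rw [h'.fderiv]
  simp [dot2]
  ring

/-- for a constant vector field `c` and a smooth `ℤ²`-periodic `v`,
`−⟨∇v·c, ∇v·c⟩ + ⟨[∇(∇v·c)]·v, c⟩ − ⟨[∇(∇v·c)]·c, v⟩ + ⟨∇v·(∇v·c), c⟩ = 0`;
these are the terms of the curvature quantity `R(u,v)` that survive when `∇u = 0`. -/
theorem curvature_R_vanishes_on_constants (c : ℝ × ℝ) (v : ℝ × ℝ → ℝ × ℝ)
    (hv : ContDiff ℝ (⊤ : ℕ∞) v) (hvp : Periodic2 v) :
    -innerH1 (fun z => jac v z c) (fun z => jac v z c)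
      + innerH1 (fun z => fderiv ℝ (fun y => jac v y c) z (v z)) (fun _ => c)
      - innerH1 (fun z => fderiv ℝ (fun y => jac v y c) z c) v
      + innerH1 (fun z => jac v z (jac v z c)) (fun _ => c) = 0 := by
  have hw : ContDiff ℝ (⊤ : ℕ∞) (fun z => fderiv ℝ v z c) := hv.fderiv_apply_smooth contDiff_const
  have hvv : ContDiff ℝ (⊤ : ℕ∞) (fun z => fderiv ℝ v z (v z)) := hv.fderiv_apply_smooth hv
  have hl := contDiff_lap2 hv
  have hA : ContDiff ℝ (⊤ : ℕ∞) (fun z => v z - lap2 v z) := hv.sub hl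
  have hdv : Differentiable ℝ v := hv.differentiable (by simp)
  have hdw := hw.differentiable (by simp)
  have hdvv := hvv.differentiable (by simp)
  have hdl := hl.differentiable (by simp)
  have hdA := hA.differentiable (by simp)
  have hdot : ∀ {f g : ℝ × ℝ → ℝ × ℝ}, ContDiff ℝ (⊤ : ℕ∞) f → ContDiff ℝ (⊤ : ℕ∞) g →
      ContDiff ℝ (⊤ : ℕ∞) (fun z => dot2 (f z) (g z)) := fun hf hg =>
    (hf.fst.mul hg.fst).add (hf.snd.mul hg.snd)
  have hP : ContDiff ℝ (⊤ : ℕ∞) (fun z => dot2 (fderiv ℝ v z (v z)) c) := hdot hvv contDiff_const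
  have hQ : ContDiff ℝ (⊤ : ℕ∞) (fun z => dot2 (fderiv ℝ v z c) (v z - lap2 v z)) := hdot hw hA
  have hzero := integral_sq01_fderiv_apply_eq_zero
    (G := fun z => dot2 (fderiv ℝ v z (v z)) c - dot2 (fderiv ℝ v z c) (v z - lap2 v z))
    ((hP.sub hQ).of_le (by exact_mod_cast le_top))
    (fun z n => by simp only [hvp.fderiv z n, hvp z n, hvp.lap2 z n]) c
  have hvvc : ∀ z, fderiv ℝ (fun y => fderiv ℝ v y (v y)) z c =
      fderiv ℝ (fun y => fderiv ℝ v y c) z (v z) + fderiv ℝ v z (fderiv ℝ v z c) := fun z => by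
    have hd : DifferentiableAt ℝ (fderiv ℝ v) z :=
      (hv.fderiv_right (m := (⊤ : ℕ∞)) (by exact_mod_cast le_top)).differentiable (by simp) z
    rw [hv.fderiv_fderiv_apply_comm, fderiv_clm_apply hd (hdv z),
      fderiv_clm_apply hd (differentiableAt_const _)]
    simp [add_comm]
  have hi1 := integrableOn_innerH1 hw hw
  have hi2 := integrableOn_innerH1 (hw.fderiv_apply_smooth hv) (contDiff_const (c := c))
  have hi3 := integrableOn_innerH1 (hw.fderiv_apply_smooth (contDiff_const (c := c))) hv
  have hi4 := integrableOn_innerH1 (hv.fderiv_apply_smooth hw) (contDiff_const (c := c))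
  simp only [innerH1, jac]
  have hsum : ∀ z, fderiv ℝ (fun y => dot2 (fderiv ℝ v y (v y)) c -
        dot2 (fderiv ℝ v y c) (v y - lap2 v y)) z c =
      (dot2 (fderiv ℝ (fun y => fderiv ℝ v y c) z (v z)) (c - lap2 (fun _ => c) z) +
        dot2 (fderiv ℝ v z (fderiv ℝ v z c)) (c - lap2 (fun _ => c) z)) -
      (dot2 (fderiv ℝ v z c) (fderiv ℝ v z c - lap2 (fun y => fderiv ℝ v y c) z) +
        dot2 (fderiv ℝ (fun y => fderiv ℝ v y c) z c) (v z - lap2 v z)) := fun z => by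
    rw [fderiv_fun_sub (hP.differentiable (by simp) z) (hQ.differentiable (by simp) z),
      sub_apply, fderiv_dot2_apply (hdvv z) (differentiableAt_const c),
      fderiv_dot2_apply (hdw z) (hdA z), hvvc, fderiv_fun_sub (hdv z) (hdl z),
      lap2_fderiv_apply hv, lap2_const]
    simp [dot2]
    ring
  simp_rw [hsum] at hzero
  have hlin := integral_sub (hi2.add hi4) (hi1.add hi3)
  simp only [Pi.add_apply] at hlin
  rw [hlin, integral_add hi2 hi4, integral_add hi1 hi3] at hzero
  linarith
end
end

section
/- Let n₁, n₂ ≥ 1 be integers, set k₁ = 2πn₁, k₂ = 2πn₂, and let v : ℝ² → ℝ² be v(x,y) = (sin(k₁x) sin(k₂y), sin(k₁x) sin(k₂y)). Let Γ : ℝ² → ℝ² be a smooth ℤ²-periodic map satisfying Γ − ΔΓ = −½[(∇v)ᵀe₁ + (∇·v)e₁] on ℝ². Then ∫_{[0,1]²} Γ·(Γ − ΔΓ) d(x,y) = (1/8)·(2k₁² + k₂²)/(1 + k₁² + k₂²); in particular this quantity is strictly positive. (This integral equals the sectional curvature S(e₁, v) = ⟨Γ(e₁,v), Γ(e₁,v)⟩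 of the right-invariant H¹ metric associated with the 2D Camassa–Holm equation, so S is positive on span{e₁, v}.) -/
open MeasureTheory Real

noncomputable section

/-- At a local maximum the second derivative of a continuous function is nonpositive. -/
lemma deriv_deriv_nonpos_of_isLocalMax {g : ℝ → ℝ} {a : ℝ} (hg : ContinuousAt g a)
    (hmax : IsLocalMax g a) : deriv (deriv g) a ≤ 0 := by
  by_contra! hpos
  have hmin : IsLocalMin g a :=
    isLocalMin_of_deriv_deriv_pos hpos hmax.deriv_eq_zero hg
  have hconst : g =ᶠ[nhds a] fun _ => g a := by
    filter_upwards [hmax, hmin] with x h₁ h₂ using le_antisymm h₁ h₂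
  have h : deriv (deriv g) a = 0 := by
    rw [hconst.deriv.deriv_eq]
    simp
  exact hpos.ne' h

lemma deriv_comp_line {h : ℝ × ℝ → ℝ} (hh : Differentiable ℝ h) (z w : ℝ × ℝ) :
    deriv (fun t : ℝ => h (z + t • w)) = fun t => fderiv ℝ h (z + t • w) w := by
  funext t
  have hl : HasDerivAt (fun t : ℝ => z + t • w) w t := by
    simpa using ((hasDerivAt_id t).smul_const w).const_add z
  exact ((hh _).hasFDerivAt.comp_hasDerivAt t hl).deriv

lemma differentiable_fderiv_apply {h : ℝ × ℝ → ℝ} (hh : ContDiff ℝ 2 h) (w : ℝ × ℝ) :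
    Differentiable ℝ (fun z => fderiv ℝ h z w) :=
  ((hh.fderiv_right (m := 1) (by norm_num)).clm_apply contDiff_const).differentiable (by simp)

/-- At a global maximum every pure second directional derivative is nonpositive. -/
lemma fderiv_fderiv_nonpos_of_forall_le {h : ℝ × ℝ → ℝ} (hh : ContDiff ℝ 2 h) {z : ℝ × ℝ}
    (hmax : ∀ y, h y ≤ h z) (w : ℝ × ℝ) :
    fderiv ℝ (fun y => fderiv ℝ h y w) z w ≤ 0 := by
  have hd : Differentiable ℝ h := hh.differentiable (by simp)
  have key := deriv_deriv_nonpos_of_isLocalMax (g := fun t : ℝ => h (z + t • w)) (a := 0)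
    (hd.continuous.comp (by fun_prop)).continuousAt
    (Filter.Eventually.of_forall fun t => by simpa using hmax (z + t • w))
  rw [deriv_comp_line hd, deriv_comp_line (differentiable_fderiv_apply hh w)] at key
  simpa using key

/-- A continuous `ℤ²`-periodic real function attains its maximum. -/
lemma Periodic2.exists_forall_le {h : ℝ × ℝ → ℝ} (hp : Periodic2 h) (hc : Continuous h) :
    ∃ z, ∀ y, h y ≤ h z := by
  obtain ⟨z, -, hz⟩ := (isCompact_Icc : IsCompact (Set.Icc ((0, 0) : ℝ × ℝ) (1, 1))).exists_isMaxOn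
    ⟨(0, 0), by simp [Prod.le_def]⟩ hc.continuousOn
  refine ⟨z, fun y => ?_⟩
  rw [← hp y (-⌊y.1⌋, -⌊y.2⌋)]
  refine hz ⟨⟨?_, ?_⟩, ⟨?_, ?_⟩⟩
  · simpa using Int.floor_le y.1
  · simpa using Int.floor_le y.2
  · have := (Int.lt_floor_add_one y.1).le
    simp only [Prod.fst_add, Int.cast_neg]
    linarith
  · have := (Int.lt_floor_add_one y.2).le
    simp only [Prod.snd_add, Int.cast_neg]
    linarith

lemma Periodic2.nonpos_of_eq_lapS {h : ℝ × ℝ → ℝ} (hp : Periodic2 h) (hh : ContDiff ℝ 2 h)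
    (heq : ∀ z, h z = lapS h z) (z : ℝ × ℝ) : h z ≤ 0 := by
  obtain ⟨m, hm⟩ := hp.exists_forall_le hh.continuous
  refine (hm z).trans ?_
  rw [heq m]
  exact add_nonpos (fderiv_fderiv_nonpos_of_forall_le hh hm _)
    (fderiv_fderiv_nonpos_of_forall_le hh hm _)

lemma lapS_sub {f g : ℝ × ℝ → ℝ} (hf : ContDiff ℝ 2 f) (hg : ContDiff ℝ 2 g) (z : ℝ × ℝ) :
    lapS (fun y => f y - g y) z = lapS f z - lapS g z := by
  have h (w y : ℝ × ℝ) :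
      fderiv ℝ (fun y => f y - g y) y w = fderiv ℝ f y w - fderiv ℝ g y w := by
    rw [fderiv_fun_sub (hf.differentiable (by simp) y) (hg.differentiable (by simp) y)]
    rfl
  simp only [lapS, h]
  rw [fderiv_fun_sub (differentiable_fderiv_apply hf _ z) (differentiable_fderiv_apply hg _ z),
    fderiv_fun_sub (differentiable_fderiv_apply hf _ z) (differentiable_fderiv_apply hg _ z)]
  simp only [sub_apply]
  ring

/-- Uniqueness of periodic solutions of the screened Poisson equation `f - Δf = r`. -/
lemma Periodic2.eq_of_sub_lapS_eq {f g : ℝ × ℝ → ℝ} (hfp : Periodic2 f) (hgp : Periodic2 g)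
    (hf : ContDiff ℝ 2 f) (hg : ContDiff ℝ 2 g)
    (heq : ∀ z, f z - lapS f z = g z - lapS g z) : f = g := by
  funext z
  refine le_antisymm (sub_nonpos.1 ?_) (sub_nonpos.1 ?_)
  · refine Periodic2.nonpos_of_eq_lapS (h := fun y => f y - g y)
      (fun y n => by simp only [hfp y n, hgp y n]) (hf.sub hg) (fun y => ?_) z
    rw [lapS_sub hf hg]
    linarith [heq y]
  · refine Periodic2.nonpos_of_eq_lapS (h := fun y => g y - f y)
      (fun y n => by simp only [hfp y n, hgp y n]) (hg.sub hf) (fun y => ?_) z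
    rw [lapS_sub hg hf]
    linarith [heq y]

lemma lap2_eq_lapS {f : ℝ × ℝ → ℝ × ℝ} (hf : ContDiff ℝ 2 f) (z : ℝ × ℝ) :
    lap2 f z = (lapS (fun y => (f y).1) z, lapS (fun y => (f y).2) z) := by
  have hd : Differentiable ℝ f := hf.differentiable (by simp)
  have hd' (w : ℝ × ℝ) : Differentiable ℝ (fun y => fderiv ℝ f y w) :=
    ((hf.fderiv_right (m := 1) (by norm_num)).clm_apply contDiff_const).differentiable (by simp)
  have h₁ {F : ℝ × ℝ → ℝ × ℝ} (hF : Differentiable ℝ F) (y w : ℝ × ℝ) :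
      fderiv ℝ (fun y => (F y).1) y w = (fderiv ℝ F y w).1 := by
    rw [(hF y).hasFDerivAt.fst.fderiv]
    rfl
  have h₂ {F : ℝ × ℝ → ℝ × ℝ} (hF : Differentiable ℝ F) (y w : ℝ × ℝ) :
      fderiv ℝ (fun y => (F y).2) y w = (fderiv ℝ F y w).2 := by
    rw [(hF y).hasFDerivAt.snd.fderiv]
    rfl
  ext <;> simp [lap2, lapS, h₁ hd, h₂ hd, h₁ (hd' _), h₂ (hd' _)]

/-- Linear combinations of the four products of `cos`, `sin` with frequencies `k₁`, `k₂`. -/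
def trigComb (k₁ k₂ a b c d : ℝ) (z : ℝ × ℝ) : ℝ :=
  a * (cos (k₁ * z.1) * cos (k₂ * z.2)) + b * (cos (k₁ * z.1) * sin (k₂ * z.2)) +
    c * (sin (k₁ * z.1) * cos (k₂ * z.2)) + d * (sin (k₁ * z.1) * sin (k₂ * z.2))

section trigComb

variable (k₁ k₂ a b c d : ℝ)

lemma contDiff_trigComb {n : WithTop ℕ∞} : ContDiff ℝ n (trigComb k₁ k₂ a b c d) := by
  unfold trigComb
  fun_prop

lemma fderiv_trigComb (z w : ℝ × ℝ) :
    fderiv ℝ (trigComb k₁ k₂ a b c d) z w =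
      w.1 * trigComb k₁ k₂ (k₁ * c) (k₁ * d) (-k₁ * a) (-k₁ * b) z +
      w.2 * trigComb k₁ k₂ (k₂ * b) (-k₂ * a) (k₂ * d) (-k₂ * c) z := by
  have hx : HasFDerivAt (fun y : ℝ × ℝ => k₁ * y.1) (k₁ • ContinuousLinearMap.fst ℝ ℝ ℝ) z :=
    hasFDerivAt_fst.const_mul k₁
  have hy : HasFDerivAt (fun y : ℝ × ℝ => k₂ * y.2) (k₂ • ContinuousLinearMap.snd ℝ ℝ ℝ) z :=
    hasFDerivAt_snd.const_mul k₂
  have h := ((((hx.cos.mul hy.cos).const_mul a).add ((hx.cos.mul hy.sin).const_mul b)).add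
    ((hx.sin.mul hy.cos).const_mul c)).add ((hx.sin.mul hy.sin).const_mul d)
  have h' : HasFDerivAt (trigComb k₁ k₂ a b c d) _ z := h
  rw [h'.fderiv]
  simp [trigComb]
  ring

lemma fderiv_trigComb_fst (z : ℝ × ℝ) :
    fderiv ℝ (trigComb k₁ k₂ a b c d) z (1, 0) =
      trigComb k₁ k₂ (k₁ * c) (k₁ * d) (-k₁ * a) (-k₁ * b) z := by
  simp [fderiv_trigComb]

lemma fderiv_trigComb_snd (z : ℝ × ℝ) :
    fderiv ℝ (trigComb k₁ k₂ a b c d) z (0, 1) =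
      trigComb k₁ k₂ (k₂ * b) (-k₂ * a) (k₂ * d) (-k₂ * c) z := by
  simp [fderiv_trigComb]

lemma lapS_trigComb (z : ℝ × ℝ) :
    lapS (trigComb k₁ k₂ a b c d) z = -(k₁ ^ 2 + k₂ ^ 2) * trigComb k₁ k₂ a b c d z := by
  have h₁ := funext (fderiv_trigComb_fst k₁ k₂ a b c d)
  have h₂ := funext (fderiv_trigComb_snd k₁ k₂ a b c d)
  rw [lapS, h₁, h₂, fderiv_trigComb_fst, fderiv_trigComb_snd]
  simp only [trigComb]
  ring

end trigComb

lemma periodic2_trigComb (n₁ n₂ : ℕ) (a b c d : ℝ) :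
    Periodic2 (trigComb (2 * π * n₁) (2 * π * n₂) a b c d) := by
  intro z m
  have h (n : ℕ) (m : ℤ) (x : ℝ) :
      2 * π * n * (x + m) = 2 * π * n * x + ((n * m : ℤ) : ℝ) * (2 * π) := by
    push_cast
    ring
  simp only [trigComb, Prod.fst_add, Prod.snd_add, h, cos_add_int_mul_two_pi,
    sin_add_int_mul_two_pi]

lemma sin_two_pi_mul_nat (n : ℕ) : sin (2 * π * n) = 0 := by
  have h := sin_nat_mul_pi (2 * n)
  push_cast at h
  rwa [mul_right_comm] at h

section integrals

variable {n : ℕ}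

lemma integral_cos_two_pi_mul_sq (hn : 1 ≤ n) :
    ∫ x in Set.Icc (0 : ℝ) 1, cos (2 * π * n * x) ^ 2 = 1 / 2 := by
  have hk : 2 * π * (n : ℝ) ≠ 0 := by positivity
  have hs : sin (2 * π * n) = 0 := sin_two_pi_mul_nat n
  rw [integral_Icc_eq_integral_Ioc, ← intervalIntegral.integral_of_le zero_le_one,
    intervalIntegral.integral_comp_mul_left (fun x => cos x ^ 2) hk, integral_cos_sq]
  simp [hs]
  field_simp

lemma integral_sin_two_pi_mul_sq (hn : 1 ≤ n) :
    ∫ x in Set.Icc (0 : ℝ) 1, sin (2 * π * n * x) ^ 2 = 1 / 2 := by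
  have hk : 2 * π * (n : ℝ) ≠ 0 := by positivity
  have hs : sin (2 * π * n) = 0 := sin_two_pi_mul_nat n
  rw [integral_Icc_eq_integral_Ioc, ← intervalIntegral.integral_of_le zero_le_one,
    intervalIntegral.integral_comp_mul_left (fun x => sin x ^ 2) hk, integral_sin_sq]
  simp [hs]
  field_simp

lemma integral_sin_mul_cos_two_pi_mul (hn : 1 ≤ n) :
    ∫ x in Set.Icc (0 : ℝ) 1, sin (2 * π * n * x) * cos (2 * π * n * x) = 0 := by
  have hk : 2 * π * (n : ℝ) ≠ 0 := by positivity
  have hs : sin (2 * π * n) = 0 := sin_two_pi_mul_nat n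
  rw [integral_Icc_eq_integral_Ioc, ← intervalIntegral.integral_of_le zero_le_one,
    intervalIntegral.integral_comp_mul_left (fun x => sin x * cos x) hk, integral_sin_mul_cos₁]
  simp [hs]

end integrals

lemma integral_sq01_mul (f g : ℝ → ℝ) :
    ∫ z in sq01, f z.1 * g z.2 =
      (∫ x in Set.Icc (0 : ℝ) 1, f x) * ∫ y in Set.Icc (0 : ℝ) 1, g y := by
  rw [sq01, Set.Icc_prod_eq, Measure.volume_eq_prod, setIntegral_prod_mul]

lemma integrableOn_sq01 {f : ℝ × ℝ → ℝ} (hf : Continuous f) : IntegrableOn f sq01 :=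
  hf.continuousOn.integrableOn_compact isCompact_Icc

lemma integral_trigComb_mul {n₁ n₂ : ℕ} (hn₁ : 1 ≤ n₁) (hn₂ : 1 ≤ n₂) (b c b' c' : ℝ) :
    ∫ z in sq01, trigComb (2 * π * n₁) (2 * π * n₂) 0 b c 0 z *
      trigComb (2 * π * n₁) (2 * π * n₂) 0 b' c' 0 z = (b * b' + c * c') / 4 := by
  have hexp (z : ℝ × ℝ) : trigComb (2 * π * n₁) (2 * π * n₂) 0 b c 0 z *
      trigComb (2 * π * n₁) (2 * π * n₂) 0 b' c' 0 z =
      b * b' * (cos (2 * π * n₁ * z.1) ^ 2 * sin (2 * π * n₂ * z.2) ^ 2) +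
      (b * c' + c * b') * ((sin (2 * π * n₁ * z.1) * cos (2 * π * n₁ * z.1)) *
        (sin (2 * π * n₂ * z.2) * cos (2 * π * n₂ * z.2))) +
      c * c' * (sin (2 * π * n₁ * z.1) ^ 2 * cos (2 * π * n₂ * z.2) ^ 2) := by
    simp only [trigComb]
    ring
  simp only [hexp]
  rw [integral_add (integrableOn_sq01 (by fun_prop)) (integrableOn_sq01 (by fun_prop)),
    integral_add (integrableOn_sq01 (by fun_prop)) (integrableOn_sq01 (by fun_prop)),
    integral_const_mul, integral_const_mul, integral_const_mul,
    integral_sq01_mul (fun x => cos (2 * π * n₁ * x) ^ 2) (fun y => sin (2 * π * n₂ * y) ^ 2),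
    integral_sq01_mul (fun x => sin (2 * π * n₁ * x) * cos (2 * π * n₁ * x))
      (fun y => sin (2 * π * n₂ * y) * cos (2 * π * n₂ * y)),
    integral_sq01_mul (fun x => sin (2 * π * n₁ * x) ^ 2) (fun y => cos (2 * π * n₂ * y) ^ 2),
    integral_cos_two_pi_mul_sq hn₁, integral_cos_two_pi_mul_sq hn₂,
    integral_sin_two_pi_mul_sq hn₁, integral_sin_two_pi_mul_sq hn₂,
    integral_sin_mul_cos_two_pi_mul hn₁]
  ring

/-- The periodic solution of `f - Δf = r` for a trigonometric right-hand side `r`. -/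
lemma Periodic2.eq_trigComb_div {n₁ n₂ : ℕ} {f : ℝ × ℝ → ℝ} (hfp : Periodic2 f)
    (hf : ContDiff ℝ 2 f) {a b c d : ℝ}
    (heq : ∀ z, f z - lapS f z = trigComb (2 * π * n₁) (2 * π * n₂) a b c d z) (z : ℝ × ℝ) :
    f z = trigComb (2 * π * n₁) (2 * π * n₂) a b c d z /
      (1 + (2 * π * n₁) ^ 2 + (2 * π * n₂) ^ 2) := by
  set k₁ := 2 * π * (n₁ : ℝ)
  set k₂ := 2 * π * (n₂ : ℝ)
  have hK : 1 + k₁ ^ 2 + k₂ ^ 2 ≠ 0 := by positivity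
  set K := 1 + k₁ ^ 2 + k₂ ^ 2 with hKdef
  have hdiv (y : ℝ × ℝ) : trigComb k₁ k₂ (a / K) (b / K) (c / K) (d / K) y =
      trigComb k₁ k₂ a b c d y / K := by
    simp only [trigComb]
    ring
  rw [← hdiv]
  refine congrFun (hfp.eq_of_sub_lapS_eq (periodic2_trigComb n₁ n₂ _ _ _ _) hf
    (contDiff_trigComb ..) fun y => ?_) z
  rw [heq, lapS_trigComb, hdiv]
  field_simp
  rw [hKdef]
  ring

/-- explicit value and positivity of the sectional curvature
`S(eᵢ, v) = ⟨Γ(eᵢ,v), Γ(eᵢ,v)⟩` of the right-invariant H¹ metric of the 2D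
Camassa–Holm equation, for `v = (sin(k₁x)sin(k₂y), sin(k₁x)sin(k₂y))`. -/
theorem sectional_curvature_positive_7 (n₁ n₂ : ℕ) (hn₁ : 1 ≤ n₁) (hn₂ : 1 ≤ n₂)
    (k₁ k₂ : ℝ) (hk₁ : k₁ = 2 * Real.pi * n₁) (hk₂ : k₂ = 2 * Real.pi * n₂)
    (v : ℝ × ℝ → ℝ × ℝ)
    (hv : v = fun z => (Real.sin (k₁ * z.1) * Real.sin (k₂ * z.2),
                        Real.sin (k₁ * z.1) * Real.sin (k₂ * z.2)))
    (Γ : ℝ × ℝ → ℝ × ℝ) (hΓ : ContDiff ℝ (⊤ : ℕ∞) Γ) (hΓp : Periodic2 Γ)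
    (hΓeq : ∀ z : ℝ × ℝ, Γ z - lap2 Γ z
      = -(1 / 2 : ℝ) • (jacT v z ((1 : ℝ), (0 : ℝ)) + div2 v z • (((1 : ℝ), (0 : ℝ)) : ℝ × ℝ))) :
    (∫ z in sq01, dot2 (Γ z) (Γ z - lap2 Γ z))
        = (1 / 8) * (2 * k₁ ^ 2 + k₂ ^ 2) / (1 + k₁ ^ 2 + k₂ ^ 2) ∧
    0 < ∫ z in sq01, dot2 (Γ z) (Γ z - lap2 Γ z) := by
  subst hk₁ hk₂
  set k₁ := 2 * π * (n₁ : ℝ)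
  set k₂ := 2 * π * (n₂ : ℝ)
  have hk₁pos : 0 < k₁ := by positivity
  have hk₂pos : 0 < k₂ := by positivity
  have hΓ2 : ContDiff ℝ 2 Γ := contDiff_infty.1 hΓ 2
  have hv' : v = fun z => (trigComb k₁ k₂ 0 0 0 1 z, trigComb k₁ k₂ 0 0 0 1 z) := by
    simp [hv, trigComb]
  have hdv (z w : ℝ × ℝ) : fderiv ℝ v z w =
      (fderiv ℝ (trigComb k₁ k₂ 0 0 0 1) z w, fderiv ℝ (trigComb k₁ k₂ 0 0 0 1) z w) := by
    have hd : DifferentiableAt ℝ (trigComb k₁ k₂ 0 0 0 1) z :=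
      (contDiff_trigComb (n := 1) ..).differentiable (by simp) z
    rw [hv', (hd.hasFDerivAt.prodMk hd.hasFDerivAt).fderiv]
    rfl
  have hrhs (z : ℝ × ℝ) : Γ z - lap2 Γ z =
      (trigComb k₁ k₂ 0 (-k₁) (-k₂ / 2) 0 z, trigComb k₁ k₂ 0 0 (-k₂ / 2) 0 z) := by
    rw [hΓeq, jacT, div2, hdv, hdv, fderiv_trigComb_fst, fderiv_trigComb_snd]
    ext
    · simp [dot2, trigComb]
      ring
    · simp [dot2, trigComb]
      ring
  have h₁ := Periodic2.eq_trigComb_div (f := fun z => (Γ z).1) (fun z n => by simp only [hΓp z n])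
    hΓ2.fst (fun z => by simpa [lap2_eq_lapS hΓ2] using congrArg Prod.fst (hrhs z))
  have h₂ := Periodic2.eq_trigComb_div (f := fun z => (Γ z).2) (fun z n => by simp only [hΓp z n])
    hΓ2.snd (fun z => by simpa [lap2_eq_lapS hΓ2] using congrArg Prod.snd (hrhs z))
  have hval : (∫ z in sq01, dot2 (Γ z) (Γ z - lap2 Γ z))
      = (1 / 8) * (2 * k₁ ^ 2 + k₂ ^ 2) / (1 + k₁ ^ 2 + k₂ ^ 2) := by
    simp only [dot2, hrhs, h₁, h₂, div_mul_eq_mul_div]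
    rw [integral_add, integral_div, integral_div, integral_trigComb_mul hn₁ hn₂,
      integral_trigComb_mul hn₁ hn₂]
    · ring
    all_goals
      exact integrableOn_sq01 ((((contDiff_trigComb (n := 0) ..).continuous).mul
        (contDiff_trigComb (n := 0) ..).continuous).div_const _)
  refine ⟨hval, ?_⟩
  rw [hval]
  positivity
end
end

section
/- Let T > 0 and let u : [0,T) × ℝ² → ℝ² be smooth; set m := u − Δu (Δ the spatial Laplacian, acting componentwise). Assume u solves the 2D Camassa–Holm equation ∂ₜm = −(u·∇)m − (∇u)ᵀm − (∇·u)m on [0,T) × ℝ², and let φ : [0,T) × ℝ² → ℝ² be smooth with ∂ₜφ(t,z) = u(t, φ(t,z)) and φ(0,z) = z for all z. Then the body momentum m₀(t,z) := (∇_z φ(t,z))ᵀ · m(t, φ(t,z)) · det ∇_z φ(t,z) is conserved: m₀(t,z) = m(0,z) for all t ∈ [0,T) and z ∈ ℝ². -/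
open MeasureTheory Real

noncomputable section

section SpaceTime

variable {E F : Type*} [NormedAddCommGroup E] [NormedSpace ℝ E]
  [NormedAddCommGroup F] [NormedSpace ℝ F] {T : ℝ} {f : ℝ → E → F}

lemma uniqueDiffOn_Ico_prod_univ : UniqueDiffOn ℝ (Set.Ico 0 T ×ˢ (Set.univ : Set E)) :=
  (uniqueDiffOn_Ico 0 T).prod uniqueDiffOn_univ

lemma Ico_prod_univ_mem_nhds {X : Type*} [TopologicalSpace X] {t : ℝ}
    (ht : t ∈ Set.Ioo 0 T) (z : X) :
    Set.Ico 0 T ×ˢ (Set.univ : Set X) ∈ nhds (t, z) :=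
  prod_mem_nhds (Ico_mem_nhds ht.1 ht.2) Filter.univ_mem

lemma HasFDerivWithinAt.hasFDerivAt_slice {L : ℝ × E →L[ℝ] F} {t : ℝ} {z : E}
    (h : HasFDerivWithinAt (Function.uncurry f) L (Set.Ico 0 T ×ˢ Set.univ) (t, z))
    (ht : t ∈ Set.Ico 0 T) :
    HasFDerivAt (f t) (L.comp (ContinuousLinearMap.inr ℝ ℝ E)) z := by
  have hp : HasFDerivWithinAt (fun w : E => (t, w)) (ContinuousLinearMap.inr ℝ ℝ E)
      Set.univ z := (hasFDerivAt_prodMk_right t z).hasFDerivWithinAt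
  have := HasFDerivWithinAt.comp z h hp (fun w _ => ⟨ht, Set.mem_univ _⟩)
  exact hasFDerivWithinAt_univ.mp this

lemma ContDiffOn.hasFDerivAt_slice
    (hf : ContDiffOn ℝ (⊤ : ℕ∞) (Function.uncurry f) (Set.Ico 0 T ×ˢ Set.univ))
    {t : ℝ} (ht : t ∈ Set.Ico 0 T) (z : E) :
    HasFDerivAt (f t)
      ((fderivWithin ℝ (Function.uncurry f) (Set.Ico 0 T ×ˢ Set.univ) (t, z)).comp
        (ContinuousLinearMap.inr ℝ ℝ E)) z :=
  (((hf.differentiableOn (by simp)) (t, z) ⟨ht, Set.mem_univ z⟩).hasFDerivWithinAt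
    ).hasFDerivAt_slice ht

lemma ContDiffOn.fderiv_slice
    (hf : ContDiffOn ℝ (⊤ : ℕ∞) (Function.uncurry f) (Set.Ico 0 T ×ˢ Set.univ)) (v : E) :
    ContDiffOn ℝ (⊤ : ℕ∞) (Function.uncurry fun t z => fderiv ℝ (f t) z v)
      (Set.Ico 0 T ×ˢ Set.univ) := by
  have h : ContDiffOn ℝ (⊤ : ℕ∞)
      (fderivWithin ℝ (Function.uncurry f) (Set.Ico 0 T ×ˢ Set.univ))
      (Set.Ico 0 T ×ˢ Set.univ) :=
    hf.fderivWithin uniqueDiffOn_Ico_prod_univ (by simp)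
  refine (h.clm_apply (contDiffOn_const (c := ((0 : ℝ), v)))).congr ?_
  rintro ⟨t, z⟩ ⟨ht, -⟩
  simp [(hf.hasFDerivAt_slice ht z).fderiv]

lemma ContDiffOn.contDiffAt_uncurry
    (hf : ContDiffOn ℝ (⊤ : ℕ∞) (Function.uncurry f) (Set.Ico 0 T ×ˢ Set.univ))
    {t : ℝ} (ht : t ∈ Set.Ioo 0 T) (z : E) :
    ContDiffAt ℝ (⊤ : ℕ∞) (Function.uncurry f) (t, z) :=
  hf.contDiffAt (Ico_prod_univ_mem_nhds ht z)

lemma HasFDerivAt.hasDerivAt_uncurry {L : ℝ × E →L[ℝ] F} {t : ℝ} {p : ℝ → E} {p' : E}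
    (h : HasFDerivAt (Function.uncurry f) L (t, p t)) (hp : HasDerivAt p p' t) :
    HasDerivAt (fun s => f s (p s)) (L (1, p')) t :=
  HasFDerivAt.comp_hasDerivAt (l := Function.uncurry f) (f := fun s => (s, p s)) t h
    ((hasDerivAt_id t).prodMk hp)

/-- The total derivative along a curve splits into its time and space parts. -/
lemma ContDiffOn.hasDerivAt_along_curve
    (hf : ContDiffOn ℝ (⊤ : ℕ∞) (Function.uncurry f) (Set.Ico 0 T ×ˢ Set.univ))
    {t : ℝ} (ht : t ∈ Set.Ioo 0 T) {p : ℝ → E} {p' : E} (hp : HasDerivAt p p' t) :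
    HasDerivAt (fun s => f s (p s))
      (deriv (fun s => f s (p t)) t + fderiv ℝ (f t) (p t) p') t := by
  have hF := ((hf.contDiffAt_uncurry ht (p t)).differentiableAt (by simp)).hasFDerivAt
  have h₂ : HasDerivAt (fun s => f s (p t)) _ t :=
    hF.hasDerivAt_uncurry (p := fun _ => p t) (hasDerivAt_const t (p t))
  have h₃ := hF.hasFDerivWithinAt.hasFDerivAt_slice (Set.Ioo_subset_Ico_self ht)
  rw [h₂.deriv, h₃.fderiv]
  convert hF.hasDerivAt_uncurry hp using 1
  simp [← map_add]

/-- Time and space derivatives commute. -/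
lemma ContDiffOn.hasDerivAt_fderiv_slice
    (hf : ContDiffOn ℝ (⊤ : ℕ∞) (Function.uncurry f) (Set.Ico 0 T ×ˢ Set.univ))
    {t : ℝ} (ht : t ∈ Set.Ioo 0 T) (z v : E) :
    HasDerivAt (fun s => fderiv ℝ (f s) z v)
      (fderiv ℝ (fun w => deriv (fun s => f s w) t) z v) t := by
  have hF := hf.contDiffAt_uncurry ht z
  have hD : HasFDerivAt (fderiv ℝ (Function.uncurry f)) _ (t, z) :=
    ((hF.fderiv_right (m := 1)
      (WithTop.coe_le_coe.mpr (le_top (a := (2 : ℕ∞))))).differentiableAt (by simp)).hasFDerivAt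
  have hsymm : IsSymmSndFDerivAt ℝ (Function.uncurry f) (t, z) :=
    hF.isSymmSndFDerivAt (by
    simpa using WithTop.coe_le_coe.mpr (le_top (a := (2 : ℕ∞))))
  have htime : ∀ w, deriv (fun s => f s w) t = fderiv ℝ (Function.uncurry f) (t, w) (1, 0) := by
    intro w
    exact (((hf.contDiffAt_uncurry ht w).differentiableAt
      (by simp)).hasFDerivAt.hasDerivAt_uncurry (hasDerivAt_const t w)).deriv
  have hspace : (fun s => fderiv ℝ (f s) z v) =ᶠ[nhds t]
      fun s => fderiv ℝ (Function.uncurry f) (s, z) (0, v) := by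
    filter_upwards [Ioo_mem_nhds ht.1 ht.2] with s hs
    rw [(((hf.contDiffAt_uncurry hs z).differentiableAt
      (by simp)).hasFDerivAt.hasFDerivWithinAt.hasFDerivAt_slice
        (Set.Ioo_subset_Ico_self hs)).fderiv]
    simp
  have hz : HasFDerivAt (fun w => fderiv ℝ (Function.uncurry f) (t, w)) _ z :=
    hD.comp z (hasFDerivAt_prodMk_right t z)
  have ht' : HasDerivAt (fun s => fderiv ℝ (Function.uncurry f) (s, z)) _ t :=
    hD.comp_hasDerivAt t ((hasDerivAt_id t).prodMk (hasDerivAt_const t z))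
  simp_rw [htime]
  rw [(hz.clm_apply (hasFDerivAt_const ((1 : ℝ), (0 : E)) z)).fderiv]
  refine ((ht'.clm_apply (hasDerivAt_const t ((0 : ℝ), v))).congr_of_eventuallyEq
    hspace).congr_deriv ?_
  simpa using hsymm (1, 0) (0, v)

end SpaceTime

lemma ContinuousLinearMap.apply_eq_coordinates (L : ℝ × ℝ →L[ℝ] ℝ × ℝ) (a : ℝ × ℝ) :
    L a = a.1 • L (1, 0) + a.2 • L (0, 1) := by
  rw [← map_smul, ← map_smul, ← map_add]
  simp

/-- The momentum equation for `p` along a flow with velocity gradient `U`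
makes `det(a, b) (a·p, b·p)` stationary, where `a` and `b` are transported by `U`. -/
lemma hasDerivAt_det_smul_dot2 {a b p : ℝ → ℝ × ℝ} {U : ℝ × ℝ →L[ℝ] ℝ × ℝ} {t : ℝ}
    (ha : HasDerivAt a (U (a t)) t) (hb : HasDerivAt b (U (b t)) t)
    (hp : HasDerivAt p (-(dot2 (U (1, 0)) (p t), dot2 (U (0, 1)) (p t)) -
      ((U (1, 0)).1 + (U (0, 1)).2) • p t) t) :
    HasDerivAt (fun s => ((a s).1 * (b s).2 - (b s).1 * (a s).2) •
      (dot2 (a s) (p s), dot2 (b s) (p s))) 0 t := by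
  rw [U.apply_eq_coordinates] at ha hb
  have ha₁ := (hasFDerivAt_fst (𝕜 := ℝ) (p := a t)).comp_hasDerivAt t ha
  have ha₂ := (hasFDerivAt_snd (𝕜 := ℝ) (p := a t)).comp_hasDerivAt t ha
  have hb₁ := (hasFDerivAt_fst (𝕜 := ℝ) (p := b t)).comp_hasDerivAt t hb
  have hb₂ := (hasFDerivAt_snd (𝕜 := ℝ) (p := b t)).comp_hasDerivAt t hb
  have hp₁ := (hasFDerivAt_fst (𝕜 := ℝ) (p := p t)).comp_hasDerivAt t hp
  have hp₂ := (hasFDerivAt_snd (𝕜 := ℝ) (p := p t)).comp_hasDerivAt t hp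
  have hdet := (ha₁.mul hb₂).sub (hb₁.mul ha₂)
  have hA := (ha₁.mul hp₁).add (ha₂.mul hp₂)
  have hB := (hb₁.mul hp₁).add (hb₂.mul hp₂)
  refine (hdet.smul (hA.prodMk hB)).congr_deriv ?_
  ext <;> simp [dot2] <;> ring

lemma eq_of_continuousOn_Ico_of_hasDerivAt_zero {T : ℝ} {g : ℝ → ℝ}
    (hc : ContinuousOn g (Set.Ico 0 T)) (hd : ∀ t ∈ Set.Ioo 0 T, HasDerivAt g 0 t)
    {t : ℝ} (ht : t ∈ Set.Ico 0 T) : g t = g 0 := by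
  rcases ht.1.eq_or_lt with h | h
  · rw [← h]
  · obtain ⟨c, -, hc'⟩ := exists_hasDerivAt_eq_slope g (fun _ => 0) h
      (hc.mono fun s hs => ⟨hs.1, hs.2.trans_lt ht.2⟩)
      (fun s hs => hd s ⟨hs.1, hs.2.trans ht.2⟩)
    rw [eq_comm, div_eq_zero_iff] at hc'
    rcases hc' with hc' | hc' <;> linarith

/-- for a solution `u` of the 2D Camassa–Holm equation with geodesic
flow `φ`, the body momentum `m₀ = (∇φ)ᵀ (m∘φ) |∇φ|` is conserved: `m₀(t,z) = m(0,z)`. -/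
theorem body_momentum_conserved_2D (T : ℝ) (hT : 0 < T)
    (u m : ℝ → ℝ × ℝ → ℝ × ℝ) (φ : ℝ → ℝ × ℝ → ℝ × ℝ)
    (hu : ContDiffOn ℝ (⊤ : ℕ∞) (Function.uncurry u) (Set.Ico 0 T ×ˢ Set.univ))
    (hφ : ContDiffOn ℝ (⊤ : ℕ∞) (Function.uncurry φ) (Set.Ico 0 T ×ˢ Set.univ))
    (hm : ∀ t z, m t z = u t z - lap2 (u t) z)
    (hCH : ∀ t ∈ Set.Ico 0 T, ∀ z : ℝ × ℝ,
      derivWithin (fun s => m s z) (Set.Ico 0 T) t =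
        -(jac (m t) z (u t z)) - jacT (u t) z (m t z) - div2 (u t) z • m t z)
    (hflow : ∀ t ∈ Set.Ico 0 T, ∀ z : ℝ × ℝ,
      derivWithin (fun s => φ s z) (Set.Ico 0 T) t = u t (φ t z))
    (hinit : ∀ z : ℝ × ℝ, φ 0 z = z) :
    ∀ t ∈ Set.Ico 0 T, ∀ z : ℝ × ℝ,
      detJac (φ t) z • jacT (φ t) z (m t (φ t z)) = m 0 z := by
  have hmS : ContDiffOn ℝ (⊤ : ℕ∞) (Function.uncurry m) (Set.Ico 0 T ×ˢ Set.univ) := by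
    refine (hu.sub (((hu.fderiv_slice (1, 0)).fderiv_slice (1, 0)).add
      ((hu.fderiv_slice (0, 1)).fderiv_slice (0, 1)))).congr ?_
    rintro ⟨t, z⟩ -
    exact hm t z
  intro t ht z
  have hslice : ContinuousOn (fun s : ℝ => (s, z)) (Set.Ico 0 T) := by fun_prop
  have hcurve : ContinuousOn (fun s => φ s z) (Set.Ico 0 T) :=
    hφ.continuousOn.comp hslice fun s hs => ⟨hs, Set.mem_univ _⟩
  have hcp : ContinuousOn (fun s => m s (φ s z)) (Set.Ico 0 T) :=
    hmS.continuousOn.comp (continuousOn_id.prodMk hcurve) fun s hs => ⟨hs, Set.mem_univ _⟩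
  have hcgrad (v : ℝ × ℝ) : ContinuousOn (fun s => fderiv ℝ (φ s) z v) (Set.Ico 0 T) :=
    (hφ.fderiv_slice v).continuousOn.comp hslice fun s hs => ⟨hs, Set.mem_univ _⟩
  have hcont : ContinuousOn (fun s => detJac (φ s) z • jacT (φ s) z (m s (φ s z)))
      (Set.Ico 0 T) := by
    have h₁ := hcgrad (1, 0)
    have h₂ := hcgrad (0, 1)
    unfold detJac jacT dot2
    exact ((h₁.fst.mul h₂.snd).sub (h₂.fst.mul h₁.snd)).smul
      (((h₁.fst.mul hcp.fst).add (h₁.snd.mul hcp.snd)).prodMk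
        ((h₂.fst.mul hcp.fst).add (h₂.snd.mul hcp.snd)))
  have hderiv : ∀ s ∈ Set.Ioo 0 T,
      HasDerivAt (fun s => detJac (φ s) z • jacT (φ s) z (m s (φ s z))) 0 s := by
    intro s hs
    have hs' := Set.Ioo_subset_Ico_self hs
    have hnhds := Ico_mem_nhds hs.1 hs.2
    have hflow' (w : ℝ × ℝ) : deriv (fun r => φ r w) s = u s (φ s w) := by
      rw [← hflow s hs' w, derivWithin_of_mem_nhds hnhds]
    have hφd : HasDerivAt (fun r => φ r z) (u s (φ s z)) s := by
      rw [← hflow' z]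
      have h : DifferentiableAt ℝ (fun r => Function.uncurry φ (r, z)) s :=
        ((hφ.contDiffAt_uncurry hs z).differentiableAt (by simp)).comp s
          (f := fun r : ℝ => (r, z)) (by fun_prop)
      exact h.hasDerivAt
    have hgrad (v : ℝ × ℝ) : HasDerivAt (fun r => fderiv ℝ (φ r) z v)
        (fderiv ℝ (u s) (φ s z) (fderiv ℝ (φ s) z v)) s := by
      have h := hφ.hasDerivAt_fderiv_slice hs z v
      simp_rw [hflow'] at h
      have hcomp : HasFDerivAt (fun w => u s (φ s w)) _ z :=
        (hu.hasFDerivAt_slice hs' (φ s z)).differentiableAt.hasFDerivAt.comp z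
          (hφ.hasFDerivAt_slice hs' z).differentiableAt.hasFDerivAt
      rw [hcomp.fderiv] at h
      exact h
    have hmom := hmS.hasDerivAt_along_curve hs hφd
    rw [← derivWithin_of_mem_nhds hnhds, hCH s hs'] at hmom
    refine hasDerivAt_det_smul_dot2 (hgrad (1, 0)) (hgrad (0, 1)) (hmom.congr_deriv ?_)
    simp only [jac, jacT, div2]
    abel
  have hconst : detJac (φ t) z • jacT (φ t) z (m t (φ t z)) =
      detJac (φ 0) z • jacT (φ 0) z (m 0 (φ 0 z)) :=
    Prod.ext
      (eq_of_continuousOn_Ico_of_hasDerivAt_zero hcont.fst (fun s hs => (hderiv s hs).fst) ht)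
      (eq_of_continuousOn_Ico_of_hasDerivAt_zero hcont.snd (fun s hs => (hderiv s hs).snd) ht)
  have hid : φ 0 = id := funext hinit
  rw [hconst, hid]
  simp [detJac, jacT, dot2]
end
end

section
/- Let T > 0 and let u : [0,T) × ℝ → ℝ be smooth; set m := u − u_{xx}. Assume u solves the Camassa–Holm equation ∂ₜm = −m_x u − 2u_x m on [0,T) × ℝ, and let φ : [0,T) × ℝ → ℝ be smooth with ∂ₜφ(t,x) = u(t, φ(t,x)) and φ(0,x) = x for all x. Then the body momentum m₀(t,x) := m(t, φ(t,x)) · (∂ₓφ(t,x))² is conserved: m₀(t,x) = m(0,x) for all t ∈ [0,T) and x ∈ ℝ. -/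
noncomputable section

open Set Function

theorem hasDerivAt_slice {I : Set ℝ} {F : ℝ → ℝ → ℝ} {t x : ℝ} {L : ℝ × ℝ →L[ℝ] ℝ}
    (ht : t ∈ I) (hF : HasFDerivWithinAt (uncurry F) L (I ×ˢ univ) (t, x)) :
    HasDerivAt (F t) (L (0, 1)) x := by
  have hc : HasDerivWithinAt (fun y : ℝ => (t, y)) ((0 : ℝ), (1 : ℝ)) univ x :=
    ((hasDerivAt_const x t).prodMk (hasDerivAt_id x)).hasDerivWithinAt
  exact (hF.comp_hasDerivWithinAt x hc fun y _ => ⟨ht, mem_univ y⟩).hasDerivAt Filter.univ_mem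

theorem hasDerivWithinAt_along_curve {I : Set ℝ} {F : ℝ → ℝ → ℝ} {γ : ℝ → ℝ} {t v : ℝ}
    {L : ℝ × ℝ →L[ℝ] ℝ} (hF : HasFDerivWithinAt (uncurry F) L (I ×ˢ univ) (t, γ t))
    (hγ : HasDerivWithinAt γ v I t) :
    HasDerivWithinAt (fun s => F s (γ s)) (L (1, v)) I t :=
  hF.comp_hasDerivWithinAt (f := fun s => (s, γ s)) t ((hasDerivWithinAt_id t I).prodMk hγ)
    fun s hs => ⟨hs, mem_univ (γ s)⟩

section Slab

variable {I : Set ℝ} {F : ℝ → ℝ → ℝ}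

theorem contDiffOn_partial (hI : UniqueDiffOn ℝ I)
    (hF : ContDiffOn ℝ (⊤ : ℕ∞) (uncurry F) (I ×ˢ univ)) (w : ℝ × ℝ) :
    ContDiffOn ℝ (⊤ : ℕ∞) (fun p => fderivWithin ℝ (uncurry F) (I ×ˢ univ) p w)
      (I ×ˢ univ) :=
  (hF.fderivWithin (hI.prod uniqueDiffOn_univ) (by simp)).clm_apply contDiffOn_const

theorem hasFDerivWithinAt_slab (hF : ContDiffOn ℝ (⊤ : ℕ∞) (uncurry F) (I ×ˢ univ))
    {t : ℝ} (ht : t ∈ I) (x : ℝ) :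
    HasFDerivWithinAt (uncurry F) (fderivWithin ℝ (uncurry F) (I ×ˢ univ) (t, x))
      (I ×ˢ univ) (t, x) :=
  (hF.differentiableOn (by simp) (t, x) ⟨ht, mem_univ x⟩).hasFDerivWithinAt

theorem deriv_slice_eq (hF : ContDiffOn ℝ (⊤ : ℕ∞) (uncurry F) (I ×ˢ univ))
    {t : ℝ} (ht : t ∈ I) (x : ℝ) :
    deriv (F t) x = fderivWithin ℝ (uncurry F) (I ×ˢ univ) (t, x) (0, 1) :=
  (hasDerivAt_slice ht (hasFDerivWithinAt_slab hF ht x)).deriv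

theorem derivWithin_slice_eq (hI : UniqueDiffOn ℝ I)
    (hF : ContDiffOn ℝ (⊤ : ℕ∞) (uncurry F) (I ×ˢ univ)) {t : ℝ} (ht : t ∈ I) (x : ℝ) :
    derivWithin (fun s => F s x) I t =
      fderivWithin ℝ (uncurry F) (I ×ˢ univ) (t, x) (1, 0) :=
  (hasDerivWithinAt_along_curve (γ := fun _ => x) (hasFDerivWithinAt_slab hF ht x)
    (hasDerivWithinAt_const t I x)).derivWithin (hI t ht)

theorem contDiffOn_deriv_slice (hI : UniqueDiffOn ℝ I)
    (hF : ContDiffOn ℝ (⊤ : ℕ∞) (uncurry F) (I ×ˢ univ)) :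
    ContDiffOn ℝ (⊤ : ℕ∞) (uncurry fun t x => deriv (F t) x) (I ×ˢ univ) :=
  (contDiffOn_partial hI hF (0, 1)).congr fun p hp => deriv_slice_eq hF hp.1 p.2

/-- Chain rule in the first variable along a curve `γ`, for a smooth function on `I × ℝ`. -/
theorem hasDerivWithinAt_comp_curve (hI : UniqueDiffOn ℝ I)
    (hF : ContDiffOn ℝ (⊤ : ℕ∞) (uncurry F) (I ×ˢ univ)) {γ : ℝ → ℝ} {t v : ℝ} (ht : t ∈ I)
    (hγ : HasDerivWithinAt γ v I t) :
    HasDerivWithinAt (fun s => F s (γ s))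
      (derivWithin (fun s => F s (γ t)) I t + deriv (F t) (γ t) * v) I t := by
  convert hasDerivWithinAt_along_curve (hasFDerivWithinAt_slab hF ht (γ t)) hγ using 1
  rw [derivWithin_slice_eq hI hF ht, deriv_slice_eq hF ht,
    show ((1 : ℝ), v) = (1, 0) + v • (0, 1) by simp, map_add, map_smul, smul_eq_mul, mul_comm v]

theorem differentiableAt_slice (hF : ContDiffOn ℝ (⊤ : ℕ∞) (uncurry F) (I ×ˢ univ))
    {t : ℝ} (ht : t ∈ I) (x : ℝ) : DifferentiableAt ℝ (F t) x :=
  (hasDerivAt_slice ht (hasFDerivWithinAt_slab hF ht x)).differentiableAt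

theorem differentiableWithinAt_slice (hF : ContDiffOn ℝ (⊤ : ℕ∞) (uncurry F) (I ×ˢ univ))
    {t : ℝ} (ht : t ∈ I) (x : ℝ) : DifferentiableWithinAt ℝ (fun s => F s x) I t :=
  (hasDerivWithinAt_along_curve (γ := fun _ => x) (hasFDerivWithinAt_slab hF ht x)
    (hasDerivWithinAt_const t I x)).differentiableWithinAt

/-- Equality of mixed partial derivatives on the slab `I × ℝ`. -/
theorem derivWithin_deriv_comm (hI : UniqueDiffOn ℝ I)
    (hF : ContDiffOn ℝ (⊤ : ℕ∞) (uncurry F) (I ×ˢ univ)) {t : ℝ} (ht : t ∈ I)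
    (ht' : t ∈ closure (interior I)) (x : ℝ) :
    derivWithin (fun s => deriv (F s) x) I t =
      deriv (fun y => derivWithin (fun s => F s y) I t) x := by
  set S : Set (ℝ × ℝ) := I ×ˢ univ with hS
  have hmem : (t, x) ∈ S := ⟨ht, mem_univ x⟩
  have hU : UniqueDiffOn ℝ S := hI.prod uniqueDiffOn_univ
  have hsymm : IsSymmSndFDerivWithinAt ℝ (uncurry F) S (t, x) := by
    refine (hF (t, x) hmem).isSymmSndFDerivWithinAt
      (by simpa using WithTop.coe_le_coe.2 (le_top : (2 : ℕ∞) ≤ ⊤)) hU ?_ hmem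
    rw [hS, interior_prod_eq, closure_prod_eq]
    exact ⟨ht', by simp⟩
  have hD : DifferentiableWithinAt ℝ (fderivWithin ℝ (uncurry F) S) S (t, x) :=
    (hF.fderivWithin hU (m := (⊤ : ℕ∞)) (by simp)).differentiableOn (by simp) (t, x) hmem
  have hP (w : ℝ × ℝ) : HasFDerivWithinAt
      (uncurry fun s y => fderivWithin ℝ (uncurry F) S (s, y) w)
      ((fderivWithin ℝ (fderivWithin ℝ (uncurry F) S) S (t, x)).flip w) S (t, x) := by
    have h := hD.hasFDerivWithinAt.clm_apply (hasFDerivWithinAt_const w (t, x) S)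
    simp only [ContinuousLinearMap.comp_zero, zero_add] at h
    exact h
  have h1 : derivWithin (fun s => deriv (F s) x) I t =
      fderivWithin ℝ (fderivWithin ℝ (uncurry F) S) S (t, x) (1, 0) (0, 1) := by
    rw [derivWithin_congr (fun s hs => deriv_slice_eq hF hs x) (deriv_slice_eq hF ht x)]
    exact (hasDerivWithinAt_along_curve (γ := fun _ => x) (hP (0, 1))
      (hasDerivWithinAt_const t I x)).derivWithin (hI t ht)
  rw [h1, funext fun y => derivWithin_slice_eq hI hF ht y, hsymm]
  exact (hasDerivAt_slice ht (hP (1, 0))).deriv.symm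

end Slab

noncomputable section

/-- for a solution `u` of the Camassa–Holm equation `m_t = −m_x u − 2u_x m`,
`m = u − u_{xx}`, with geodesic flow `φ`, the body momentum `m₀ = (m∘φ)·φ_x²` is
conserved: `m₀(t,x) = m(0,x)`. -/
theorem body_momentum_conserved_CH (T : ℝ) (hT : 0 < T)
    (u m : ℝ → ℝ → ℝ) (φ : ℝ → ℝ → ℝ)
    (hu : ContDiffOn ℝ (⊤ : ℕ∞) (Function.uncurry u) (Set.Ico 0 T ×ˢ Set.univ))
    (hφ : ContDiffOn ℝ (⊤ : ℕ∞) (Function.uncurry φ) (Set.Ico 0 T ×ˢ Set.univ))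
    (hm : ∀ t x, m t x = u t x - deriv (deriv (u t)) x)
    (hCH : ∀ t ∈ Set.Ico 0 T, ∀ x : ℝ,
      derivWithin (fun s => m s x) (Set.Ico 0 T) t =
        -(deriv (m t) x) * u t x - 2 * deriv (u t) x * m t x)
    (hflow : ∀ t ∈ Set.Ico 0 T, ∀ x : ℝ,
      derivWithin (fun s => φ s x) (Set.Ico 0 T) t = u t (φ t x))
    (hinit : ∀ x : ℝ, φ 0 x = x) :
    ∀ t ∈ Set.Ico 0 T, ∀ x : ℝ,
      m t (φ t x) * (deriv (φ t) x) ^ 2 = m 0 x := by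
  set I : Set ℝ := Ico 0 T
  have hI : UniqueDiffOn ℝ I := uniqueDiffOn_Ico 0 T
  have hux := contDiffOn_deriv_slice hI hu
  have hm_smooth : ContDiffOn ℝ (⊤ : ℕ∞) (uncurry m) (I ×ˢ univ) :=
    (hu.sub (contDiffOn_deriv_slice hI hux)).congr fun p _ => hm p.1 p.2
  have hφx := contDiffOn_deriv_slice hI hφ
  have key (x t : ℝ) (ht : t ∈ I) :
      HasDerivWithinAt (fun s => m s (φ s x) * deriv (φ s) x ^ 2) 0 I t := by
    have hφt : HasDerivWithinAt (fun s => φ s x) (u t (φ t x)) I t :=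
      hflow t ht x ▸ (differentiableWithinAt_slice hφ ht x).hasDerivWithinAt
    have hmφ := hasDerivWithinAt_comp_curve hI hm_smooth ht hφt
    have hcl : t ∈ closure (interior I) := by
      rw [interior_Ico, closure_Ioo hT.ne]
      exact ⟨ht.1, ht.2.le⟩
    have hφxt : HasDerivWithinAt (fun s => deriv (φ s) x)
        (deriv (u t) (φ t x) * deriv (φ t) x) I t := by
      refine (differentiableWithinAt_slice hφx ht x).hasDerivWithinAt.congr_deriv ?_
      rw [derivWithin_deriv_comm hI hφ ht hcl x, funext (hflow t ht)]
      exact ((differentiableAt_slice hu ht _).hasDerivAt.comp x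
        (differentiableAt_slice hφ ht x).hasDerivAt).deriv
    refine (hmφ.mul (hφxt.pow 2)).congr_deriv ?_
    rw [hCH t ht, Pi.pow_apply]
    push_cast
    ring
  intro t ht x
  have h0 : (0 : ℝ) ∈ I := ⟨le_rfl, hT⟩
  have hφ0 : φ 0 = id := funext hinit
  have hconst := (convex_Ico 0 T).is_const_of_fderivWithin_eq_zero (𝕜 := ℝ)
    (fun s hs => (key x s hs).differentiableWithinAt)
    (fun s hs => by
      simpa using (key x s hs).hasFDerivWithinAt.fderivWithin (hI s hs)) ht h0
  simpa [hφ0] using hconst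
end
end
end

section
/- Let v, ρ, g, q : ℝ × ℝ → ℝ be smooth functions of (t,x) with q = v − v_{xx} and g − g_{xx} = ρ. Define u, m : ℝ × ℝ² → ℝ² by u(t,x,y) := (v(t,x), g(t,x)) and m(t,x,y) := (q(t,x), ρ(t,x)). Then u and m satisfy the 2D Camassa–Holm equation ∂ₜm = −(u·∇)m − (∇u)ᵀm − (∇·u)m if and only if (q, v, ρ) satisfies the modified two-component Camassa–Holm (MCH2) system q_t + v q_x + 2 q v_x + ρ g_x = 0 and ρ_t + (ρ v)_x = 0. -/
open MeasureTheory Real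

noncomputable section

/-- The Fréchet derivative of a planar map `(f x, g x)` that does not depend on `y`. -/
theorem fderiv_prodMk_comp_fst {f g : ℝ → ℝ} {z : ℝ × ℝ}
    (hf : DifferentiableAt ℝ f z.1) (hg : DifferentiableAt ℝ g z.1) (w : ℝ × ℝ) :
    fderiv ℝ (fun z : ℝ × ℝ => (f z.1, g z.1)) z w = (w.1 * deriv f z.1, w.1 * deriv g z.1) := by
  have h := (hf.hasDerivAt.hasFDerivAt.comp z hasFDerivAt_fst).prodMk
    (hg.hasDerivAt.hasFDerivAt.comp z hasFDerivAt_fst)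
  have h' : fderiv ℝ (fun z : ℝ × ℝ => (f z.1, g z.1)) z = _ := h.fderiv
  rw [h']
  simp

/-- A smooth function of two variables is differentiable in the second one. -/
theorem differentiable_of_contDiff_uncurry {f : ℝ → ℝ → ℝ}
    (hf : ContDiff ℝ (⊤ : ℕ∞) (Function.uncurry f)) (t : ℝ) : Differentiable ℝ (f t) :=
  (hf.differentiable (by simp)).comp
    ((differentiable_const t).prodMk differentiable_id)

/-- A smooth function of two variables is differentiable in the first one. -/
theorem differentiable_left_of_contDiff_uncurry {f : ℝ → ℝ → ℝ}
    (hf : ContDiff ℝ (⊤ : ℕ∞) (Function.uncurry f)) (x : ℝ) :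
    Differentiable ℝ (fun t => f t x) :=
  (hf.differentiable (by simp)).comp
    (differentiable_id.prodMk (differentiable_const x))

/-- the 2D Camassa–Holm equation with `u = (v, g)`, `m = (q, ρ)`,
`q = v − v_{xx}`, `g − g_{xx} = ρ` (all independent of `y`) holds if and only if
`(q, v, ρ)` solves the modified two-component Camassa–Holm (MCH2) system. -/
theorem twoDCH_iff_MCH2 (v ρ g q : ℝ → ℝ → ℝ)
    (hv : ContDiff ℝ (⊤ : ℕ∞) (Function.uncurry v))
    (hρ : ContDiff ℝ (⊤ : ℕ∞) (Function.uncurry ρ))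
    (hg : ContDiff ℝ (⊤ : ℕ∞) (Function.uncurry g))
    (hq : ContDiff ℝ (⊤ : ℕ∞) (Function.uncurry q))
    (hqv : ∀ t x, q t x = v t x - deriv (deriv (v t)) x)
    (hgρ : ∀ t x, g t x - deriv (deriv (g t)) x = ρ t x)
    (u m : ℝ → ℝ × ℝ → ℝ × ℝ)
    (hu : ∀ t z, u t z = (v t z.1, g t z.1))
    (hm : ∀ t z, m t z = (q t z.1, ρ t z.1)) :
    (∀ (t : ℝ) (z : ℝ × ℝ),
        deriv (fun s => m s z) t =
          -(jac (m t) z (u t z)) - jacT (u t) z (m t z) - div2 (u t) z • m t z)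
      ↔
    (∀ (t x : ℝ),
        deriv (fun s => q s x) t + v t x * deriv (q t) x + 2 * q t x * deriv (v t) x
            + ρ t x * deriv (g t) x = 0 ∧
        deriv (fun s => ρ s x) t + deriv (fun y => ρ t y * v t y) x = 0) := by
  have hv' := differentiable_of_contDiff_uncurry hv
  have hρ' := differentiable_of_contDiff_uncurry hρ
  have hg' := differentiable_of_contDiff_uncurry hg
  have hq' := differentiable_of_contDiff_uncurry hq
  have hut : ∀ t, u t = fun z => (v t z.1, g t z.1) := fun t => funext (hu t)
  have hmt : ∀ t, m t = fun z => (q t z.1, ρ t z.1) := fun t => funext (hm t)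
  have key : ∀ (t : ℝ) (z : ℝ × ℝ),
      (deriv (fun s => m s z) t =
          -(jac (m t) z (u t z)) - jacT (u t) z (m t z) - div2 (u t) z • m t z) ↔
      (deriv (fun s => q s z.1) t + v t z.1 * deriv (q t) z.1
            + 2 * q t z.1 * deriv (v t) z.1 + ρ t z.1 * deriv (g t) z.1 = 0 ∧
        deriv (fun s => ρ s z.1) t + deriv (fun y => ρ t y * v t y) z.1 = 0) := by
    intro t z
    have hd : deriv (fun s => m s z) t =
        (deriv (fun s => q s z.1) t, deriv (fun s => ρ s z.1) t) := by
      simp only [hm]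
      exact ((differentiable_left_of_contDiff_uncurry hq z.1 t).hasDerivAt.prodMk
        (differentiable_left_of_contDiff_uncurry hρ z.1 t).hasDerivAt).deriv
    have hprod : deriv (fun y => ρ t y * v t y) z.1 =
        deriv (ρ t) z.1 * v t z.1 + ρ t z.1 * deriv (v t) z.1 :=
      ((hρ' t z.1).hasDerivAt.mul (hv' t z.1).hasDerivAt).deriv
    rw [hd, hprod]
    simp only [jac, jacT, div2, dot2, hut, hmt,
      fderiv_prodMk_comp_fst (hq' t z.1) (hρ' t z.1),
      fderiv_prodMk_comp_fst (hv' t z.1) (hg' t z.1), Prod.ext_iff, Prod.fst_sub, Prod.snd_sub,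
      Prod.fst_neg, Prod.snd_neg, Prod.smul_fst, Prod.smul_snd, smul_eq_mul]
    constructor <;> rintro ⟨h₁, h₂⟩ <;> constructor <;> linarith
  exact ⟨fun h t x => (key t (x, 0)).1 (h t (x, 0)), fun h t z => (key t z).2 (h t z.1)⟩
end
end
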